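/- If the state ρ_{AB₁B₂} is pure (ρ_{AB₁B₂} = |ψ⟩⟨ψ| for a unit vector |ψ⟩), then the tripartite uncertainty bound is saturated: S(R|AB₁)_κ + S(A|B₂)_ω = S(R)_κ + D(κ_{AB₁} ‖ ω_{AB₁}) + max{0, I(A:B₁)_ω − I(B₁:B₂)_ρ + S(A|B₁B₂)_ρ}. -/

import Mathlib

open scoped Kronecker Classical ComplexOrder
open Matrix

noncomputable section

/-- The rank-one projector `|v⟩⟨v|`. -/
def proj {α : Type*} (v : α → ℂ) : Matrix α α ℂ := Matrix.vecMulVec v (star v)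

/-- Matrix logarithm of a Hermitian matrix, via the spectral decomposition
(junk value `0` on non-Hermitian matrices; eigenvalue `0` contributes `log 0 = 0`). -/
def mlog {n : Type*} [Fintype n] [DecidableEq n] (ρ : Matrix n n ℂ) : Matrix n n ℂ :=
  if h : ρ.IsHermitian then
    (h.eigenvectorUnitary : Matrix n n ℂ) *
      Matrix.diagonal (fun i => (Real.log (h.eigenvalues i) : ℂ)) *
      (h.eigenvectorUnitary : Matrix n n ℂ)ᴴ
  else 0

/-- Von Neumann entropy `S(ρ) = -Tr ρ log ρ`. -/
def vN {n : Type*} [Fintype n] [DecidableEq n] (ρ : Matrix n n ℂ) : ℝ :=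
  -(Matrix.trace (ρ * mlog ρ)).re

/-- Quantum relative entropy `D(ρ‖σ) = Tr ρ (log ρ - log σ)`. -/
def relent {n : Type*} [Fintype n] [DecidableEq n] (ρ σ : Matrix n n ℂ) : ℝ :=
  (Matrix.trace (ρ * (mlog ρ - mlog σ))).re

/-- The rotation `e^{-iGr}` generated by the Hermitian operator `G` with orthonormal
eigenbasis `g` and eigenvalues `gv`. -/
def Urot {iA : Type*} [Fintype iA] (g : iA → iA → ℂ) (gv : iA → ℝ) (r : ℝ) : Matrix iA iA ℂ :=
  ∑ l, Complex.exp (-(Complex.I) * (gv l) * r) • proj (g l)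

section Tripartite

variable {iR iA iB1 iB2 : Type*} [Fintype iR] [Fintype iA] [Fintype iB1] [Fintype iB2]
  [DecidableEq iR] [DecidableEq iA] [DecidableEq iB1] [DecidableEq iB2]

/-- `e^{-iGr} ⊗ I_{B₁} ⊗ I_{B₂}`. -/
def UA3
    (g : iA → iA → ℂ) (gv : iA → ℝ) (r : ℝ) :
    Matrix ((iA × iB1) × iB2) ((iA × iB1) × iB2) ℂ :=
  (Urot g gv r ⊗ₖ (1 : Matrix iB1 iB1 ℂ)) ⊗ₖ (1 : Matrix iB2 iB2 ℂ)

/-- `κ_{RAB₁B₂} = Σ_k p_k |r_k⟩⟨r_k| ⊗ (e^{-iGr_k}⊗I) ρ (e^{iGr_k}⊗I)`. -/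
def kappa3
    (p : iR → ℝ) (rb : iR → iR → ℂ) (rv : iR → ℝ) (g : iA → iA → ℂ) (gv : iA → ℝ)
    (ρ : Matrix ((iA × iB1) × iB2) ((iA × iB1) × iB2) ℂ) :
    Matrix (iR × ((iA × iB1) × iB2)) (iR × ((iA × iB1) × iB2)) ℂ :=
  ∑ k, (p k : ℂ) • (proj (rb k) ⊗ₖ (UA3 g gv (rv k) * ρ * (UA3 g gv (rv k))ᴴ))

/-- `ω_{AB₁B₂} = Σ_l (|g_l⟩⟨g_l|⊗I) ρ (|g_l⟩⟨g_l|⊗I)`. -/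
def omega3 
    (g : iA → iA → ℂ)
    (ρ : Matrix ((iA × iB1) × iB2) ((iA × iB1) × iB2) ℂ) :
    Matrix ((iA × iB1) × iB2) ((iA × iB1) × iB2) ℂ :=
  ∑ l, ((proj (g l) ⊗ₖ (1 : Matrix iB1 iB1 ℂ)) ⊗ₖ (1 : Matrix iB2 iB2 ℂ)) * ρ *
       ((proj (g l) ⊗ₖ (1 : Matrix iB1 iB1 ℂ)) ⊗ₖ (1 : Matrix iB2 iB2 ℂ))

/-- Reduced state on `RAB₁` of a state on `RAB₁B₂`. -/
def redRAB1 
    (τ : Matrix (iR × ((iA × iB1) × iB2)) (iR × ((iA × iB1) × iB2)) ℂ) :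
    Matrix (iR × (iA × iB1)) (iR × (iA × iB1)) ℂ :=
  Matrix.of fun x y => ∑ k : iB2, τ (x.1, (x.2, k)) (y.1, (y.2, k))

/-- Reduced state on `AB₁` of a state on `RAB₁B₂`. -/
def redAB1four 
    (τ : Matrix (iR × ((iA × iB1) × iB2)) (iR × ((iA × iB1) × iB2)) ℂ) :
    Matrix (iA × iB1) (iA × iB1) ℂ :=
  Matrix.of fun x y => ∑ k : iR, ∑ m : iB2, τ (k, (x, m)) (k, (y, m))

/-- Reduced state on `R` of a state on `RAB₁B₂`. -/
def redRfour 
    (τ : Matrix (iR × ((iA × iB1) × iB2)) (iR × ((iA × iB1) × iB2)) ℂ) :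
    Matrix iR iR ℂ :=
  Matrix.of fun i j => ∑ x : (iA × iB1) × iB2, τ (i, x) (j, x)

/-- Reduced state on `AB₁` of a state on `AB₁B₂`. -/
def redAB1 
    (σ : Matrix ((iA × iB1) × iB2) ((iA × iB1) × iB2) ℂ) :
    Matrix (iA × iB1) (iA × iB1) ℂ :=
  Matrix.of fun x y => ∑ k : iB2, σ (x, k) (y, k)

/-- Reduced state on `AB₂` of a state on `AB₁B₂`. -/
def redAB2 
    (σ : Matrix ((iA × iB1) × iB2) ((iA × iB1) × iB2) ℂ) :
    Matrix (iA × iB2) (iA × iB2) ℂ :=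
  Matrix.of fun x y => ∑ m : iB1, σ ((x.1, m), x.2) ((y.1, m), y.2)

/-- Reduced state on `B₂` of a state on `AB₁B₂`. -/
def redB2 
    (σ : Matrix ((iA × iB1) × iB2) ((iA × iB1) × iB2) ℂ) :
    Matrix iB2 iB2 ℂ :=
  Matrix.of fun i j => ∑ x : iA × iB1, σ (x, i) (x, j)

/-- Reduced state on `A` of a state on `AB₁B₂`. -/
def redA3 
    (σ : Matrix ((iA × iB1) × iB2) ((iA × iB1) × iB2) ℂ) :
    Matrix iA iA ℂ :=
  Matrix.of fun i j => ∑ m : iB1, ∑ k : iB2, σ ((i, m), k) ((j, m), k)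

/-- Reduced state on `B₁` of a state on `AB₁B₂`. -/
def redB1 
    (σ : Matrix ((iA × iB1) × iB2) ((iA × iB1) × iB2) ℂ) :
    Matrix iB1 iB1 ℂ :=
  Matrix.of fun i j => ∑ a : iA, ∑ k : iB2, σ ((a, i), k) ((a, j), k)

/-- Reduced state on `B₁B₂` of a state on `AB₁B₂`. -/
def redB1B2 
    (σ : Matrix ((iA × iB1) × iB2) ((iA × iB1) × iB2) ℂ) :
    Matrix (iB1 × iB2) (iB1 × iB2) ℂ :=
  Matrix.of fun x y => ∑ a : iA, σ ((a, x.1), x.2) ((a, y.1), y.2)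

end Tripartite


lemma aeval_intertwine {m n : Type*} [Fintype m] [Fintype n] [DecidableEq m] [DecidableEq n]
    {M : Matrix m m ℂ} {N : Matrix n n ℂ} {X : Matrix m n ℂ} (h : M * X = X * N)
    (q : Polynomial ℂ) : Polynomial.aeval M q * X = X * Polynomial.aeval N q := by
  induction q using Polynomial.induction_on' with
  | add p q hp hq => simp only [map_add, Matrix.add_mul, Matrix.mul_add, hp, hq]
  | monomial k a =>
    have hk : M ^ k * X = X * N ^ k := by
      induction k with
      | zero => simp
      | succ k ih => rw [pow_succ', pow_succ, Matrix.mul_assoc, ih, ← Matrix.mul_assoc, h,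
          Matrix.mul_assoc, ← pow_succ', pow_succ]
    simp [Polynomial.aeval_monomial, Algebra.algebraMap_eq_smul_one, hk]

lemma aeval_diag {n : Type*} [Fintype n] [DecidableEq n] (d : n → ℂ) (q : Polynomial ℂ) :
    Polynomial.aeval (Matrix.diagonal d) q = Matrix.diagonal (fun i => q.eval (d i)) := by
  have h := Polynomial.aeval_algHom_apply (Matrix.diagonalAlgHom (n := n) (α := ℂ) ℂ) d q
  simp only [Matrix.diagonalAlgHom_apply] at h
  rw [h]
  congr 1
  ext i
  simp [Polynomial.aeval_def]

/-- a polynomial agreeing with `log` on a finite set -/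
lemma exists_log_poly (s : Finset ℝ) :
    ∃ q : Polynomial ℂ, ∀ x ∈ s, q.eval (x : ℂ) = (Real.log x : ℂ) :=
  ⟨Lagrange.interpolate s (fun x : ℝ => (x : ℂ)) (fun x => (Real.log x : ℂ)), fun x hx =>
    Lagrange.eval_interpolate_at_node (v := fun x : ℝ => (x : ℂ)) _
      (fun a _ b _ h => Complex.ofReal_injective h) hx⟩

lemma aeval_conj {n : Type*} [Fintype n] [DecidableEq n] {U : Matrix n n ℂ}
    (h1 : Uᴴ * U = 1) (h2 : U * Uᴴ = 1) (d : n → ℂ) (q : Polynomial ℂ) :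
    Polynomial.aeval (U * Matrix.diagonal d * Uᴴ) q
      = U * Matrix.diagonal (fun i => q.eval (d i)) * Uᴴ := by
  rw [← aeval_diag, ← aeval_intertwine (M := U * Matrix.diagonal d * Uᴴ),
    Matrix.mul_assoc (Polynomial.aeval _ q), h2, Matrix.mul_one]
  rw [Matrix.mul_assoc, h1, Matrix.mul_one]

lemma eig_unitary1 {n : Type*} [Fintype n] [DecidableEq n] {M : Matrix n n ℂ}
    (h : M.IsHermitian) : (h.eigenvectorUnitary : Matrix n n ℂ)ᴴ * h.eigenvectorUnitary = 1 :=
  Unitary.coe_star_mul_self _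

lemma eig_unitary2 {n : Type*} [Fintype n] [DecidableEq n] {M : Matrix n n ℂ}
    (h : M.IsHermitian) : (h.eigenvectorUnitary : Matrix n n ℂ) *
      (h.eigenvectorUnitary : Matrix n n ℂ)ᴴ = 1 :=
  Unitary.coe_mul_star_self _

lemma eig_spec {n : Type*} [Fintype n] [DecidableEq n] {M : Matrix n n ℂ}
    (h : M.IsHermitian) : M = (h.eigenvectorUnitary : Matrix n n ℂ) *
      Matrix.diagonal (fun i => (h.eigenvalues i : ℂ)) *
      (h.eigenvectorUnitary : Matrix n n ℂ)ᴴ := by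
  have := h.spectral_theorem
  rw [Unitary.conjStarAlgAut_apply] at this
  exact this

lemma mlog_poly {n : Type*} [Fintype n] [DecidableEq n] {M : Matrix n n ℂ}
    (h : M.IsHermitian) (q : Polynomial ℂ)
    (hq : ∀ i, q.eval (h.eigenvalues i : ℂ) = (Real.log (h.eigenvalues i) : ℂ)) :
    mlog M = Polynomial.aeval M q := by
  conv_rhs => rw [eig_spec h]
  rw [aeval_conj (eig_unitary1 h) (eig_unitary2 h), mlog, dif_pos h]
  simp only [hq]

lemma mlog_poly2 {m n : Type*} [Fintype m] [Fintype n] [DecidableEq m] [DecidableEq n]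
    {M : Matrix m m ℂ} {N : Matrix n n ℂ} (hM : M.IsHermitian) (hN : N.IsHermitian) :
    ∃ q : Polynomial ℂ, mlog M = Polynomial.aeval M q ∧ mlog N = Polynomial.aeval N q := by
  obtain ⟨q, hq⟩ := exists_log_poly
    (Finset.univ.image hM.eigenvalues ∪ Finset.univ.image hN.eigenvalues)
  exact ⟨q, mlog_poly hM q fun i => hq _ (by simp), mlog_poly hN q fun i => hq _ (by simp)⟩

lemma mlog_intertwine {m n : Type*} [Fintype m] [Fintype n] [DecidableEq m] [DecidableEq n]
    {M : Matrix m m ℂ} {N : Matrix n n ℂ} (hM : M.IsHermitian) (hN : N.IsHermitian)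
    {X : Matrix m n ℂ} (h : M * X = X * N) : mlog M * X = X * mlog N := by
  obtain ⟨q, h1, h2⟩ := mlog_poly2 hM hN
  rw [h1, h2, aeval_intertwine h]

lemma vN_transpose {n : Type*} [Fintype n] [DecidableEq n]
    {N : Matrix n n ℂ} (hN : N.IsHermitian) : vN Nᵀ = vN N := by
  obtain ⟨q, h1, h2⟩ := mlog_poly2 hN.transpose hN
  have h3 : ∀ q : Polynomial ℂ, Polynomial.aeval Nᵀ q = (Polynomial.aeval N q)ᵀ := by
    intro q
    induction q using Polynomial.induction_on' with
    | add p q hp hq => simp only [map_add, Matrix.transpose_add, hp, hq]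
    | monomial k a =>
      simp [Polynomial.aeval_monomial, Algebra.algebraMap_eq_smul_one, Matrix.transpose_pow]
  rw [vN, vN, h1, h2, h3, ← Matrix.transpose_mul, Matrix.trace_transpose, Matrix.trace_mul_comm]

lemma vN_conj {n : Type*} [Fintype n] [DecidableEq n] {U M : Matrix n n ℂ}
    (h1 : Uᴴ * U = 1) (h2 : U * Uᴴ = 1) (d : n → ℝ)
    (hM : M = U * Matrix.diagonal (fun i => (d i : ℂ)) * Uᴴ) :
    vN M = ∑ i, Real.negMulLog (d i) := by
  have hH : M.IsHermitian := by
    rw [Matrix.IsHermitian, hM]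
    simp only [Matrix.conjTranspose_mul, Matrix.diagonal_conjTranspose,
      Matrix.conjTranspose_conjTranspose, Matrix.mul_assoc]
    congr; ext; simp
  obtain ⟨q, hq⟩ := exists_log_poly
    (Finset.univ.image hH.eigenvalues ∪ Finset.univ.image d)
  have h3 : mlog M = U * Matrix.diagonal (fun i => (Real.log (d i) : ℂ)) * Uᴴ := by
    rw [mlog_poly hH q (fun i => hq _ (by simp)), hM, aeval_conj h1 h2]
    congr; ext i; exact hq _ (by simp)
  have h4 : M * mlog M = U * (Matrix.diagonal (fun i => ((d i * Real.log (d i) : ℝ) : ℂ)) * Uᴴ) := by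
    rw [h3, hM]
    calc _ = U * (Matrix.diagonal (fun i => (d i : ℂ)) * (Uᴴ * U) *
        Matrix.diagonal (fun i => (Real.log (d i) : ℂ)) * Uᴴ) := by simp only [Matrix.mul_assoc]
      _ = _ := by rw [h1]; simp [Matrix.diagonal_mul_diagonal]
  rw [vN, h4, Matrix.trace_mul_comm, Matrix.mul_assoc, h1, Matrix.mul_one, Matrix.trace_diagonal,
    ← Complex.ofReal_sum, Complex.ofReal_re]
  simp [Real.negMulLog]

lemma vN_eig {n : Type*} [Fintype n] [DecidableEq n] {M : Matrix n n ℂ}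
    (h : M.IsHermitian) : vN M = ∑ i, Real.negMulLog (h.eigenvalues i) :=
  vN_conj (eig_unitary1 h) (eig_unitary2 h) _ (eig_spec h)

lemma sum_eig {n : Type*} [Fintype n] [DecidableEq n] {M : Matrix n n ℂ}
    (h : M.IsHermitian) : ∑ i, h.eigenvalues i = M.trace.re := by
  rw [h.trace_eq_sum_eigenvalues]; simp

lemma vN_smul {n : Type*} [Fintype n] [DecidableEq n] {M : Matrix n n ℂ}
    (h : M.IsHermitian) (c : ℝ) :
    vN ((c : ℂ) • M) = M.trace.re * Real.negMulLog c + c * vN M := by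
  rw [vN_conj (M := (c : ℂ) • M) (eig_unitary1 h) (eig_unitary2 h) (fun i => c * h.eigenvalues i),
    vN_eig h, ← sum_eig h]
  · simp [Real.negMulLog_mul, Finset.sum_add_distrib, Finset.sum_mul, Finset.mul_sum]
  · conv_lhs => rw [eig_spec h]
    rw [← Matrix.smul_mul, ← Matrix.mul_smul, ← Matrix.diagonal_smul]
    congr; ext; simp

lemma vN_ge {n : Type*} [Fintype n] [DecidableEq n] {M : Matrix n n ℂ}
    (h : M.PosSemidef) : Real.negMulLog M.trace.re ≤ vN M := by
  rw [vN_eig h.1, ← sum_eig h.1]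
  have hnn := h.eigenvalues_nonneg
  simp only [Real.negMulLog, neg_mul, Finset.sum_mul, Finset.sum_neg_distrib]
  apply neg_le_neg
  apply Finset.sum_le_sum
  intro i _
  rcases (hnn i).eq_or_lt with h0 | h0
  · simp [← h0]
  · apply mul_le_mul_of_nonneg_left _ h0.le
    exact Real.log_le_log h0 (Finset.single_le_sum (fun i _ => hnn i) (Finset.mem_univ i))

lemma vN_one {x : ℝ} : vN (Matrix.of fun _ _ : Unit => (x : ℂ)) = Real.negMulLog x := by
  rw [vN_conj (U := 1) (by simp) (by simp) (fun _ : Unit => x)]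
  · simp
  · ext i j; simp

lemma vN_swap {m n : Type*} [Fintype m] [Fintype n] [DecidableEq m] [DecidableEq n]
    (C : Matrix m n ℂ) : vN (C * Cᴴ) = vN (Cᴴ * C) := by
  have h := mlog_intertwine (Matrix.isHermitian_mul_conjTranspose_self C)
    (Matrix.isHermitian_conjTranspose_mul_self C) (X := C) (by simp [Matrix.mul_assoc])
  rw [vN, vN, Matrix.mul_assoc, Matrix.trace_mul_comm, Matrix.mul_assoc, h, ← Matrix.mul_assoc]

lemma vN_block {m n k : Type*} [Fintype m] [Fintype n] [DecidableEq m] [DecidableEq n]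
    [Fintype k] [DecidableEq k] (V : k → Matrix m n ℂ) (N : k → Matrix n n ℂ)
    (hN : ∀ l, (N l).IsHermitian)
    (hV : ∀ l l', (V l)ᴴ * V l' = if l = l' then 1 else 0) :
    vN (∑ l, V l * N l * (V l)ᴴ) = ∑ l, vN (N l) := by
  set M := ∑ l, V l * N l * (V l)ᴴ with hM
  have hH : M.IsHermitian := by
    rw [Matrix.IsHermitian, hM, Matrix.conjTranspose_sum]
    exact Finset.sum_congr rfl fun l _ => by
      simp [Matrix.conjTranspose_mul, Matrix.mul_assoc, (hN l).eq]
  have hi : ∀ l, mlog M * V l = V l * mlog (N l) := fun l => by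
    apply mlog_intertwine hH (hN l)
    rw [hM, Matrix.sum_mul, Finset.sum_eq_single l]
    · rw [Matrix.mul_assoc, hV]; simp
    · intro b _ hb; rw [Matrix.mul_assoc, hV]; simp [hb]
    · simp
  have : (M * mlog M).trace = ∑ l, (N l * mlog (N l)).trace := by
    conv_lhs => rw [hM, Finset.sum_mul, Matrix.trace_sum]
    refine Finset.sum_congr rfl fun l _ => ?_
    rw [Matrix.mul_assoc, Matrix.mul_assoc, Matrix.trace_mul_comm, Matrix.mul_assoc,
      Matrix.mul_assoc, hi, ← Matrix.mul_assoc (V l)ᴴ, hV]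
    simp
  simp only [vN, this, Complex.re_sum, Finset.sum_neg_distrib]

lemma relent_pinch {n k : Type*} [Fintype n] [DecidableEq n] [Fintype k] [DecidableEq k]
    (P : k → Matrix n n ℂ) (K W : Matrix n n ℂ) (hW : W.IsHermitian)
    (hP : ∀ l l', P l * P l' = if l = l' then P l else 0) (hP1 : ∑ l, P l = 1)
    (hWK : W = ∑ l, P l * K * P l) : relent K W = - vN K + vN W := by
  have hc : ∀ l, mlog W * P l = P l * mlog W := fun l => by
    apply mlog_intertwine hW hW
    rw [hWK, Finset.sum_mul, Finset.mul_sum, Finset.sum_eq_single l, Finset.sum_eq_single l]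
    · simp only [Matrix.mul_assoc, hP]
      simp only [← Matrix.mul_assoc, hP]; simp
    · intro b _ hb; simp [← Matrix.mul_assoc, hP, hb.symm]
    · simp
    · intro b _ hb; simp [Matrix.mul_assoc, hP, hb]
    · simp
  have key : ∀ L : Matrix n n ℂ, (∀ l, L * P l = P l * L) →
      (K * L).trace = (W * L).trace := by
    intro L hL
    rw [hWK, Matrix.sum_mul, Matrix.trace_sum]
    conv_lhs => rw [← Matrix.mul_one K, ← hP1, Matrix.mul_sum, Matrix.sum_mul, Matrix.trace_sum]
    refine Finset.sum_congr rfl fun l _ => ?_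
    have h2 := hP l l
    simp only [if_true] at h2
    calc (K * P l * L).trace = (K * (P l * P l) * L).trace := by rw [h2]
      _ = (K * P l * L * P l).trace := by
        rw [Matrix.mul_assoc (K * P l), hL]; simp only [Matrix.mul_assoc]
      _ = _ := by rw [Matrix.trace_mul_comm]; simp only [Matrix.mul_assoc]
  have := key _ hc
  rw [relent, Matrix.mul_sub, Matrix.trace_sub, this, vN, vN, Complex.sub_re]
  ring

lemma vN_schmidt {m n : Type*} [Fintype m] [Fintype n] [DecidableEq m] [DecidableEq n]
    (D : Matrix m n ℂ) : vN (D * Dᴴ) = vN (Dᵀ * Dᵀᴴ) := by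
  rw [vN_swap, ← vN_transpose (Matrix.isHermitian_conjTranspose_mul_self D),
    Matrix.transpose_mul]
  rfl

def emb {ι m n : Type*} (v : ι → ℂ) (U : Matrix m n ℂ) : Matrix (ι × m) n ℂ :=
  Matrix.of fun i y => v i.1 * U i.2 y

lemma emb_conj {ι m n : Type*} [Fintype n] (v : ι → ℂ) (U : Matrix m n ℂ) (M : Matrix n n ℂ) :
    emb v U * M * (emb v U)ᴴ = proj v ⊗ₖ (U * M * Uᴴ) := by
  ext ⟨a, b⟩ ⟨a', b'⟩
  simp only [emb, proj, Matrix.mul_apply, Matrix.of_apply, Matrix.conjTranspose_apply,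
    Matrix.kroneckerMap_apply, Matrix.vecMulVec_apply, Pi.star_apply, star_mul', Finset.mul_sum,
    Finset.sum_mul]
  refine Finset.sum_congr rfl fun x _ => Finset.sum_congr rfl fun y _ => ?_
  ring

lemma emb_adj {ι m n n' : Type*} [Fintype ι] [Fintype m] (v w : ι → ℂ) (U : Matrix m n ℂ)
    (W : Matrix m n' ℂ) : (emb v U)ᴴ * emb w W = (star v ⬝ᵥ w) • (Uᴴ * W) := by
  ext a b
  simp only [emb, Matrix.mul_apply, Matrix.of_apply, Matrix.conjTranspose_apply,
    Matrix.smul_apply, smul_eq_mul, dotProduct, Pi.star_apply, star_mul', Finset.sum_mul_sum,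
    Fintype.sum_prod_type]
  refine Finset.sum_congr rfl fun x _ => Finset.sum_congr rfl fun y _ => ?_
  ring

lemma vN_cq {ι k m : Type*} [Fintype ι] [Fintype m] [Fintype k] [DecidableEq ι] [DecidableEq m]
    [DecidableEq k] (g : k → ι → ℂ)
    (hg : ∀ l m, star (g l) ⬝ᵥ g m = if l = m then 1 else 0)
    (U : k → Matrix m m ℂ) (hU : ∀ l, (U l)ᴴ * U l = 1)
    (N : k → Matrix m m ℂ) (hN : ∀ l, (N l).IsHermitian) :
    vN (∑ l, proj (g l) ⊗ₖ (U l * N l * (U l)ᴴ)) = ∑ l, vN (N l) := by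
  rw [← vN_block (fun l => emb (g l) (U l)) N hN]
  · simp only [emb_conj]
  · intro l l'
    rw [emb_adj, hg]
    split_ifs with h
    · subst h; simp [hU]
    · simp

lemma vN_classical {ι k : Type*} [Fintype ι] [Fintype k] [DecidableEq ι]
    [DecidableEq k] (g : k → ι → ℂ)
    (hg : ∀ l m, star (g l) ⬝ᵥ g m = if l = m then 1 else 0) (c : k → ℝ) :
    vN (∑ l, (c l : ℂ) • proj (g l)) = ∑ l, Real.negMulLog (c l) := by
  simp only [← vN_one]
  rw [← vN_block (fun l => Matrix.of fun i (_ : Unit) => g l i)]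
  · congr 1
    refine Finset.sum_congr rfl fun l _ => ?_
    ext i j
    simp [proj, Matrix.mul_apply, Matrix.vecMulVec_apply]
    ring
  · intro l; ext; simp
  · intro l l'
    ext i j
    have := hg l l'
    simp only [dotProduct, Pi.star_apply] at this
    simp only [Matrix.mul_apply, Matrix.conjTranspose_apply, Matrix.of_apply, this]
    split_ifs <;> simp

lemma conj_proj {m n : Type*} [Fintype n] (X : Matrix m n ℂ) (v : n → ℂ) :
    X * proj v * Xᴴ = proj (X *ᵥ v) := by
  rw [proj, proj, Matrix.mul_vecMulVec, Matrix.vecMulVec_mul, Matrix.star_mulVec]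

lemma proj_herm {n : Type*} (v : n → ℂ) : (proj v)ᴴ = proj v := by
  rw [proj, Matrix.conjTranspose_vecMulVec, star_star]

lemma proj_mul {n : Type*} [Fintype n] (v w : n → ℂ) :
    proj v * proj w = (star v ⬝ᵥ w) • Matrix.vecMulVec v (star w) := by
  rw [proj, proj, Matrix.vecMulVec_mul_vecMulVec]
  ext i j; simp [Matrix.vecMulVec_apply]; ring

section parts
variable {iR iA iB1 iB2 : Type*} [Fintype iR] [Fintype iA] [Fintype iB1] [Fintype iB2]
  [DecidableEq iR] [DecidableEq iA] [DecidableEq iB1] [DecidableEq iB2]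

lemma redAB1_conj (X Y : Matrix (iA × iB1) (iA × iB1) ℂ)
    (σ : Matrix ((iA × iB1) × iB2) ((iA × iB1) × iB2) ℂ) :
    redAB1 ((X ⊗ₖ (1 : Matrix iB2 iB2 ℂ)) * σ * (Y ⊗ₖ (1 : Matrix iB2 iB2 ℂ)))
      = X * redAB1 σ * Y := by
  ext i j
  simp only [redAB1, Matrix.mul_apply, Matrix.of_apply, Matrix.kroneckerMap_apply,
    Fintype.sum_prod_type (α₁ := iA × iB1), Matrix.one_apply, mul_ite, mul_one, mul_zero, ite_mul,
    zero_mul, Finset.sum_ite_eq, Finset.sum_ite_eq', Finset.mem_univ, if_true, Finset.mul_sum,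
    Finset.sum_mul]
  rw [Finset.sum_comm]
  refine Finset.sum_congr rfl fun x _ => ?_
  rw [Finset.sum_comm]

lemma redAB1_sum {k : Type*} [Fintype k]
    (σ : k → Matrix ((iA × iB1) × iB2) ((iA × iB1) × iB2) ℂ) :
    redAB1 (∑ l, σ l) = ∑ l, redAB1 (σ l) := by
  ext i j
  simp only [redAB1, Matrix.of_apply, Matrix.sum_apply]
  rw [Finset.sum_comm]

lemma redB1B2_sum {k : Type*} [Fintype k]
    (σ : k → Matrix ((iA × iB1) × iB2) ((iA × iB1) × iB2) ℂ) :
    redB1B2 (∑ l, σ l) = ∑ l, redB1B2 (σ l) := by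
  ext i j
  simp only [redB1B2, Matrix.of_apply, Matrix.sum_apply]
  rw [Finset.sum_comm]

lemma redB1B2_cyc (X Y : Matrix iA iA ℂ)
    (σ : Matrix ((iA × iB1) × iB2) ((iA × iB1) × iB2) ℂ) :
    redB1B2 (((X ⊗ₖ (1 : Matrix iB1 iB1 ℂ)) ⊗ₖ (1 : Matrix iB2 iB2 ℂ)) * σ *
      ((Y ⊗ₖ (1 : Matrix iB1 iB1 ℂ)) ⊗ₖ (1 : Matrix iB2 iB2 ℂ)))
      = redB1B2 ((((Y * X) ⊗ₖ (1 : Matrix iB1 iB1 ℂ)) ⊗ₖ (1 : Matrix iB2 iB2 ℂ)) * σ) := by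
  ext ⟨b, c⟩ ⟨b', c'⟩
  simp only [redB1B2, Matrix.mul_apply, Matrix.of_apply, Matrix.kroneckerMap_apply,
    Fintype.sum_prod_type, Matrix.one_apply, mul_ite, mul_one, mul_zero, ite_mul,
    zero_mul, Finset.sum_ite_eq, Finset.sum_ite_eq', Finset.mem_univ, if_true, Finset.mul_sum,
    Finset.sum_mul, Finset.sum_ite_irrel, Finset.sum_const_zero]
  rw [Finset.sum_comm]
  refine Finset.sum_congr rfl fun x _ => ?_
  rw [Finset.sum_comm]
  refine Finset.sum_congr rfl fun y _ => Finset.sum_congr rfl fun z _ => ?_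
  ring

lemma redB1B2_omega (g : iA → iA → ℂ)
    (hg : ∀ l m, star (g l) ⬝ᵥ g m = if l = m then 1 else 0)
    (hgc : ∑ l, proj (g l) = (1 : Matrix iA iA ℂ))
    (σ : Matrix ((iA × iB1) × iB2) ((iA × iB1) × iB2) ℂ) :
    redB1B2 (omega3 g σ) = redB1B2 σ := by
  rw [omega3, redB1B2_sum]
  simp only [redB1B2_cyc, proj_mul, hg, if_true, one_smul]
  change ∑ l, redB1B2 (((proj (g l)) ⊗ₖ (1 : Matrix iB1 iB1 ℂ)) ⊗ₖ (1 : Matrix iB2 iB2 ℂ) * σ) = _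
  rw [← redB1B2_sum, ← Matrix.sum_mul]
  have : ∑ l, ((proj (g l)) ⊗ₖ (1 : Matrix iB1 iB1 ℂ)) ⊗ₖ (1 : Matrix iB2 iB2 ℂ) = 1 := by
    have h : ∑ l, ((proj (g l)) ⊗ₖ (1 : Matrix iB1 iB1 ℂ)) ⊗ₖ (1 : Matrix iB2 iB2 ℂ)
        = ((∑ l, proj (g l)) ⊗ₖ (1 : Matrix iB1 iB1 ℂ)) ⊗ₖ (1 : Matrix iB2 iB2 ℂ) := by
      ext i j
      simp [Matrix.sum_apply, Finset.sum_mul]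
    rw [h, hgc]; simp
  rw [this, Matrix.one_mul]

lemma redB1_of (σ τ : Matrix ((iA × iB1) × iB2) ((iA × iB1) × iB2) ℂ)
    (h : redB1B2 σ = redB1B2 τ) : redB1 σ = redB1 τ := by
  ext i j
  simp only [redB1, Matrix.of_apply]
  rw [Finset.sum_comm, Finset.sum_comm (γ := iA)]
  exact Finset.sum_congr rfl fun k _ => congrFun (congrFun h (i, k)) (j, k)

lemma redB2_of (σ τ : Matrix ((iA × iB1) × iB2) ((iA × iB1) × iB2) ℂ)
    (h : redB1B2 σ = redB1B2 τ) : redB2 σ = redB2 τ := by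
  ext i j
  simp only [redB2, Matrix.of_apply, Fintype.sum_prod_type]
  rw [Finset.sum_comm, Finset.sum_comm (γ := iA)]
  exact Finset.sum_congr rfl fun k _ => congrFun (congrFun h (k, i)) (k, j)

/-- conditional amplitudes -/
def amp (g : iA → iA → ℂ) (ψ : ((iA × iB1) × iB2) → ℂ) (l : iA) : Matrix iB1 iB2 ℂ :=
  Matrix.of fun b c => ∑ a, star (g l a) * ψ ((a, b), c)

lemma omega_pure (g : iA → iA → ℂ) (ψ : ((iA × iB1) × iB2) → ℂ) :
    omega3 g (proj ψ) = ∑ l, proj (fun x => g l x.1.1 * amp g ψ l x.1.2 x.2) := by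
  rw [omega3]
  refine Finset.sum_congr rfl fun l _ => ?_
  have h := conj_proj ((proj (g l) ⊗ₖ (1 : Matrix iB1 iB1 ℂ)) ⊗ₖ (1 : Matrix iB2 iB2 ℂ)) ψ
  rw [Matrix.conjTranspose_kronecker, Matrix.conjTranspose_kronecker, proj_herm,
    Matrix.conjTranspose_one, Matrix.conjTranspose_one] at h
  rw [h]
  congr 1
  ext ⟨⟨a, b⟩, c⟩
  simp [Matrix.mulVec, dotProduct, Fintype.sum_prod_type, Matrix.one_apply, amp, proj,
    Matrix.vecMulVec_apply, Finset.mul_sum, mul_assoc, Finset.sum_ite_irrel]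

lemma redAB1_omega (g : iA → iA → ℂ) (ψ : ((iA × iB1) × iB2) → ℂ) :
    redAB1 (omega3 g (proj ψ)) = ∑ l, proj (g l) ⊗ₖ (amp g ψ l * (amp g ψ l)ᴴ) := by
  rw [omega_pure, redAB1_sum]
  refine Finset.sum_congr rfl fun l _ => ?_
  ext ⟨a, b⟩ ⟨a', b'⟩
  simp only [redAB1, proj, Matrix.of_apply, Matrix.vecMulVec_apply, Pi.star_apply, star_mul',
    Matrix.kroneckerMap_apply, Matrix.mul_apply, Matrix.conjTranspose_apply, Finset.mul_sum]
  refine Finset.sum_congr rfl fun x _ => ?_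
  ring

lemma redAB2_omega (g : iA → iA → ℂ) (ψ : ((iA × iB1) × iB2) → ℂ) :
    redAB2 (omega3 g (proj ψ)) = ∑ l, proj (g l) ⊗ₖ ((amp g ψ l)ᵀ * (amp g ψ l)ᵀᴴ) := by
  rw [omega_pure]
  ext ⟨a, b⟩ ⟨a', b'⟩
  simp only [redAB2, proj, Matrix.of_apply, Matrix.vecMulVec_apply, Pi.star_apply, star_mul',
    Matrix.kroneckerMap_apply, Matrix.mul_apply, Matrix.conjTranspose_apply, Finset.mul_sum,
    Matrix.sum_apply, Matrix.transpose_apply]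
  rw [Finset.sum_comm]
  refine Finset.sum_congr rfl fun x _ => Finset.sum_congr rfl fun y _ => ?_
  ring

lemma redA3_omega (g : iA → iA → ℂ) (ψ : ((iA × iB1) × iB2) → ℂ) :
    redA3 (omega3 g (proj ψ)) =
      ∑ l, (((amp g ψ l * (amp g ψ l)ᴴ).trace.re : ℝ) : ℂ) • proj (g l) := by
  have hre : ∀ l, (((amp g ψ l * (amp g ψ l)ᴴ).trace.re : ℝ) : ℂ)
      = (amp g ψ l * (amp g ψ l)ᴴ).trace := fun l => by
    have := (Matrix.posSemidef_self_mul_conjTranspose (amp g ψ l)).trace_nonneg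
    exact (Complex.eq_re_of_ofReal_le (r := 0) (by simpa using this)).symm
  simp only [hre]
  rw [omega_pure]
  ext a a'
  simp only [redA3, proj, Matrix.of_apply, Matrix.vecMulVec_apply, Pi.star_apply, star_mul',
    Matrix.smul_apply, smul_eq_mul, Matrix.trace, Matrix.diag,
    Matrix.mul_apply, Matrix.conjTranspose_apply, Finset.sum_mul,
    Matrix.sum_apply]
  simp only [Finset.sum_comm (γ := iA)]
  refine Finset.sum_congr rfl fun x _ => ?_
  refine Finset.sum_congr rfl fun y _ => Finset.sum_congr rfl fun z _ => ?_
  ring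

lemma redAB1_pure (ψ : ((iA × iB1) × iB2) → ℂ) :
    redAB1 (proj ψ) = (Matrix.of fun x c => ψ (x, c)) * (Matrix.of fun x c => ψ (x, c))ᴴ := by
  ext i j
  simp [redAB1, proj, Matrix.mul_apply, Matrix.vecMulVec_apply]

lemma redB2_pure (ψ : ((iA × iB1) × iB2) → ℂ) :
    redB2 (proj ψ) = (Matrix.of fun x c => ψ (x, c))ᵀ * (Matrix.of fun x c => ψ (x, c))ᵀᴴ := by
  ext i j
  simp [redB2, proj, Matrix.mul_apply, Matrix.vecMulVec_apply]

lemma Urot_proj (g : iA → iA → ℂ) (gv : iA → ℝ)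
    (hg : ∀ l m, star (g l) ⬝ᵥ g m = if l = m then 1 else 0) (r : ℝ) (l : iA) :
    proj (g l) * Urot g gv r = Complex.exp (-(Complex.I) * (gv l) * r) • proj (g l) := by
  rw [Urot, Finset.mul_sum, Finset.sum_eq_single l]
  · simp [proj_mul, hg]; rfl
  · intro b _ hb; simp [proj_mul, hg, hb.symm]
  · simp

lemma Urot_adj (g : iA → iA → ℂ) (gv : iA → ℝ) (r : ℝ) :
    (Urot g gv r)ᴴ = Urot g gv (-r) := by
  rw [Urot, Urot, Matrix.conjTranspose_sum]
  refine Finset.sum_congr rfl fun l _ => ?_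
  rw [Matrix.conjTranspose_smul, proj_herm, Complex.star_def, ← Complex.exp_conj]
  simp

lemma Urot_unitary (g : iA → iA → ℂ) (gv : iA → ℝ)
    (hg : ∀ l m, star (g l) ⬝ᵥ g m = if l = m then 1 else 0)
    (hgc : ∑ l, proj (g l) = (1 : Matrix iA iA ℂ)) (r : ℝ) :
    (Urot g gv r)ᴴ * Urot g gv r = 1 := by
  rw [Urot_adj]
  conv_lhs => rw [Urot, Finset.sum_mul]
  simp only [Matrix.smul_mul, Urot_proj g gv hg, smul_smul, ← Complex.exp_add]
  simp [hgc]

lemma UAB_unitary (g : iA → iA → ℂ) (gv : iA → ℝ)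
    (hg : ∀ l m, star (g l) ⬝ᵥ g m = if l = m then 1 else 0)
    (hgc : ∑ l, proj (g l) = (1 : Matrix iA iA ℂ)) (r : ℝ) :
    (Urot g gv r ⊗ₖ (1 : Matrix iB1 iB1 ℂ))ᴴ * (Urot g gv r ⊗ₖ (1 : Matrix iB1 iB1 ℂ)) = 1 := by
  rw [Matrix.conjTranspose_kronecker, ← Matrix.mul_kronecker_mul, Urot_unitary g gv hg hgc]
  simp

lemma redAB1_rot (g : iA → iA → ℂ) (gv : iA → ℝ) (r : ℝ)
    (σ : Matrix ((iA × iB1) × iB2) ((iA × iB1) × iB2) ℂ) :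
    redAB1 (UA3 g gv r * σ * (UA3 g gv r)ᴴ) =
      (Urot g gv r ⊗ₖ (1 : Matrix iB1 iB1 ℂ)) * redAB1 σ *
        (Urot g gv r ⊗ₖ (1 : Matrix iB1 iB1 ℂ))ᴴ := by
  rw [← redAB1_conj, UA3, Matrix.conjTranspose_kronecker (_ ⊗ₖ _), Matrix.conjTranspose_one]

lemma redRAB1_kappa (p : iR → ℝ) (rb : iR → iR → ℂ) (rv : iR → ℝ) (g : iA → iA → ℂ) (gv : iA → ℝ)
    (σ : Matrix ((iA × iB1) × iB2) ((iA × iB1) × iB2) ℂ) :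
    redRAB1 (kappa3 p rb rv g gv σ) = ∑ k, proj (rb k) ⊗ₖ
      ((Urot g gv (rv k) ⊗ₖ (1 : Matrix iB1 iB1 ℂ)) * ((p k : ℂ) • redAB1 σ) *
        (Urot g gv (rv k) ⊗ₖ (1 : Matrix iB1 iB1 ℂ))ᴴ) := by
  simp only [Matrix.mul_smul, Matrix.smul_mul, ← redAB1_rot, kappa3]
  ext i j
  simp only [redRAB1, redAB1, Matrix.of_apply, Matrix.sum_apply, Matrix.smul_apply,
    Matrix.kroneckerMap_apply, smul_eq_mul, Finset.mul_sum]
  rw [Finset.sum_comm]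
  refine Finset.sum_congr rfl fun x _ => Finset.sum_congr rfl fun y _ => ?_
  ring

lemma proj_trace {n : Type*} [Fintype n] (v : n → ℂ) : ∑ i, proj v i i = star v ⬝ᵥ v := by
  simp [proj, Matrix.vecMulVec_apply, dotProduct, mul_comm]

lemma redAB1four_kappa (p : iR → ℝ) (rb : iR → iR → ℂ)
    (hrb : ∀ k m, star (rb k) ⬝ᵥ rb m = if k = m then 1 else 0)
    (rv : iR → ℝ) (g : iA → iA → ℂ) (gv : iA → ℝ)
    (σ : Matrix ((iA × iB1) × iB2) ((iA × iB1) × iB2) ℂ) :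
    redAB1four (kappa3 p rb rv g gv σ) = ∑ k, (p k : ℂ) •
      ((Urot g gv (rv k) ⊗ₖ (1 : Matrix iB1 iB1 ℂ)) * redAB1 σ *
        (Urot g gv (rv k) ⊗ₖ (1 : Matrix iB1 iB1 ℂ))ᴴ) := by
  simp only [← redAB1_rot, kappa3]
  suffices gen : ∀ τ : iR → Matrix ((iA × iB1) × iB2) ((iA × iB1) × iB2) ℂ,
      redAB1four (∑ k, (p k : ℂ) • (proj (rb k) ⊗ₖ τ k)) = ∑ k, (p k : ℂ) • redAB1 (τ k) from gen _
  intro τ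
  ext i j
  simp only [redAB1four, redAB1, Matrix.of_apply, Matrix.sum_apply, Matrix.smul_apply,
    Matrix.kroneckerMap_apply, smul_eq_mul]
  have : ∀ r : iR, ∑ m : iB2, ∑ k, (p k : ℂ) * (proj (rb k) r r * τ k (i, m) (j, m)) =
      ∑ k, (p k : ℂ) * (proj (rb k) r r * ∑ m : iB2, τ k (i, m) (j, m)) := fun r => by
    rw [Finset.sum_comm]; simp only [Finset.mul_sum]
  simp only [this]
  rw [Finset.sum_comm]
  refine Finset.sum_congr rfl fun k _ => ?_
  rw [← Finset.mul_sum, ← Finset.sum_mul, proj_trace, hrb]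
  simp

lemma redRfour_kappa (p : iR → ℝ) (rb : iR → iR → ℂ)
    (rv : iR → ℝ) (g : iA → iA → ℂ) (gv : iA → ℝ)
    (hg : ∀ l m, star (g l) ⬝ᵥ g m = if l = m then 1 else 0)
    (hgc : ∑ l, proj (g l) = (1 : Matrix iA iA ℂ))
    (σ : Matrix ((iA × iB1) × iB2) ((iA × iB1) × iB2) ℂ) (hσ : σ.trace = 1) :
    redRfour (kappa3 p rb rv g gv σ) = ∑ k, (p k : ℂ) • proj (rb k) := by
  have ht : ∀ r, (UA3 g gv r * σ * (UA3 g gv r)ᴴ).trace = 1 := fun r => by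
    rw [Matrix.trace_mul_comm, ← Matrix.mul_assoc, UA3, Matrix.conjTranspose_kronecker,
      ← Matrix.mul_kronecker_mul, UAB_unitary g gv hg hgc]
    simp [hσ]
  ext i j
  simp only [redRfour, kappa3, Matrix.of_apply, Matrix.sum_apply, Matrix.smul_apply,
    Matrix.kroneckerMap_apply, smul_eq_mul]
  rw [Finset.sum_comm]
  refine Finset.sum_congr rfl fun k _ => ?_
  have := ht (rv k)
  simp only [Matrix.trace, Matrix.diag] at this
  rw [← Finset.mul_sum, ← Finset.mul_sum, this, mul_one]

lemma redAB1_omega_pinch (p : iR → ℝ) (hps : ∑ k, p k = 1) (rv : iR → ℝ)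
    (g : iA → iA → ℂ) (gv : iA → ℝ)
    (hg : ∀ l m, star (g l) ⬝ᵥ g m = if l = m then 1 else 0)
    (σ : Matrix ((iA × iB1) × iB2) ((iA × iB1) × iB2) ℂ) :
    redAB1 (omega3 g σ) = ∑ l, (proj (g l) ⊗ₖ (1 : Matrix iB1 iB1 ℂ)) * (∑ k, (p k : ℂ) •
      ((Urot g gv (rv k) ⊗ₖ (1 : Matrix iB1 iB1 ℂ)) * redAB1 σ *
        (Urot g gv (rv k) ⊗ₖ (1 : Matrix iB1 iB1 ℂ))ᴴ)) *
        (proj (g l) ⊗ₖ (1 : Matrix iB1 iB1 ℂ)) := by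
  rw [omega3, redAB1_sum]
  refine Finset.sum_congr rfl fun l _ => ?_
  rw [redAB1_conj, Finset.mul_sum, Finset.sum_mul]
  have h1 : ∀ k, (proj (g l) ⊗ₖ (1 : Matrix iB1 iB1 ℂ)) *
      (Urot g gv (rv k) ⊗ₖ (1 : Matrix iB1 iB1 ℂ)) =
      Complex.exp (-(Complex.I) * (gv l) * (rv k)) • (proj (g l) ⊗ₖ (1 : Matrix iB1 iB1 ℂ)) := by
    intro k
    rw [← Matrix.mul_kronecker_mul, Urot_proj g gv hg, Matrix.smul_kronecker, Matrix.one_mul]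
  have h2 : ∀ k, (Urot g gv (rv k) ⊗ₖ (1 : Matrix iB1 iB1 ℂ))ᴴ *
      (proj (g l) ⊗ₖ (1 : Matrix iB1 iB1 ℂ)) =
      star (Complex.exp (-(Complex.I) * (gv l) * (rv k))) •
        (proj (g l) ⊗ₖ (1 : Matrix iB1 iB1 ℂ)) := by
    intro k
    have := congrArg Matrix.conjTranspose (h1 k)
    rw [Matrix.conjTranspose_mul, Matrix.conjTranspose_smul,
      Matrix.conjTranspose_kronecker (proj (g l)), proj_herm, Matrix.conjTranspose_one] at this
    exact this
  have h3 : ∀ k, (proj (g l) ⊗ₖ (1 : Matrix iB1 iB1 ℂ)) * ((p k : ℂ) •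
      ((Urot g gv (rv k) ⊗ₖ (1 : Matrix iB1 iB1 ℂ)) * redAB1 σ *
        (Urot g gv (rv k) ⊗ₖ (1 : Matrix iB1 iB1 ℂ))ᴴ)) *
        (proj (g l) ⊗ₖ (1 : Matrix iB1 iB1 ℂ)) = (p k : ℂ) •
        ((proj (g l) ⊗ₖ (1 : Matrix iB1 iB1 ℂ)) * redAB1 σ *
          (proj (g l) ⊗ₖ (1 : Matrix iB1 iB1 ℂ))) := by
    intro k
    rw [Matrix.mul_smul, Matrix.smul_mul]
    congr 1
    have hph : Complex.exp (-(Complex.I) * (gv l) * (rv k)) *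
        star (Complex.exp (-(Complex.I) * (gv l) * (rv k))) = 1 := by
      rw [Complex.star_def, ← Complex.exp_conj, ← Complex.exp_add]
      simp
    rw [Matrix.mul_assoc _ _ (proj (g l) ⊗ₖ (1 : Matrix iB1 iB1 ℂ)), Matrix.mul_assoc _ _
      (proj (g l) ⊗ₖ (1 : Matrix iB1 iB1 ℂ)), h2, ← Matrix.mul_assoc, ← Matrix.mul_assoc, h1,
      Matrix.mul_smul, Matrix.smul_mul, Matrix.smul_mul, smul_smul, mul_comm, hph, one_smul]
  simp only [h3]
  rw [← Finset.sum_smul, ← Complex.ofReal_sum, hps]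
  simp

end parts


/-- **Saturation of the tripartite bound for pure states**: if `ρ_{AB₁B₂}` is pure, then
`S(R|AB₁)_κ + S(A|B₂)_ω = S(R)_κ + D(κ_{AB₁}‖ω_{AB₁})
  + max{0, I(A:B₁)_ω − I(B₁:B₂)_ρ + S(A|B₁B₂)_ρ}`. -/
theorem tripartite_entropic_uncertainty_saturation_pure
    {iR iA iB1 iB2 : Type*} [Fintype iR] [Fintype iA] [Fintype iB1] [Fintype iB2]
    [DecidableEq iR] [DecidableEq iA] [DecidableEq iB1] [DecidableEq iB2]
    (ρ : Matrix ((iA × iB1) × iB2) ((iA × iB1) × iB2) ℂ)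
    (hρ : ρ.PosSemidef) (hρtr : ρ.trace = 1)
    (hpure : ∃ ψ : ((iA × iB1) × iB2) → ℂ, star ψ ⬝ᵥ ψ = 1 ∧ ρ = proj ψ)
    (g : iA → iA → ℂ) (gv : iA → ℝ)
    (hg : ∀ l m, star (g l) ⬝ᵥ g m = if l = m then 1 else 0)
    (hgc : ∑ l, proj (g l) = (1 : Matrix iA iA ℂ))
    (rb : iR → iR → ℂ)
    (hrb : ∀ k m, star (rb k) ⬝ᵥ rb m = if k = m then 1 else 0)
    (hrbc : ∑ k, proj (rb k) = (1 : Matrix iR iR ℂ))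
    (rv : iR → ℝ) (p : iR → ℝ) (hp : ∀ k, 0 ≤ p k) (hps : ∑ k, p k = 1) :
    (vN (redRAB1 (kappa3 p rb rv g gv ρ)) - vN (redAB1four (kappa3 p rb rv g gv ρ)))
      + (vN (redAB2 (omega3 g ρ)) - vN (redB2 (omega3 g ρ)))
    = vN (redRfour (kappa3 p rb rv g gv ρ))
      + relent (redAB1four (kappa3 p rb rv g gv ρ)) (redAB1 (omega3 g ρ))
      + max 0
        ((vN (redA3 (omega3 g ρ)) + vN (redB1 (omega3 g ρ)) - vN (redAB1 (omega3 g ρ)))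
          - (vN (redB1 ρ) + vN (redB2 ρ) - vN (redB1B2 ρ))
          + (vN ρ - vN (redB1B2 ρ))) := by
  obtain ⟨ψ, hψ, rfl⟩ := hpure
  have hB := redB1B2_omega (iB1 := iB1) (iB2 := iB2) g hg hgc (proj ψ)
  rw [redB1_of _ _ hB, redB2_of _ _ hB]
  -- pure state has zero entropy
  have hρ0 : vN (proj ψ) = 0 := by
    have := vN_classical (fun _ : Unit => ψ) (by simp [hψ]) (fun _ => 1)
    simpa using this
  -- the classical register
  have hR : vN (redRfour (kappa3 p rb rv g gv (proj ψ))) = ∑ k, Real.negMulLog (p k) := by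
    rw [redRfour_kappa p rb rv g gv hg hgc _ hρtr, vN_classical rb hrb]
  have hH : (redAB1 (proj ψ)).IsHermitian := by
    rw [redAB1_pure]; exact Matrix.isHermitian_mul_conjTranspose_self _
  have htr : (redAB1 (proj ψ)).trace = 1 := by
    rw [← hρtr]
    simp [redAB1, Matrix.trace, Fintype.sum_prod_type]
  have hRAB : vN (redRAB1 (kappa3 p rb rv g gv (proj ψ))) =
      ∑ k, Real.negMulLog (p k) + vN (redAB1 (proj ψ)) := by
    rw [redRAB1_kappa, vN_cq rb hrb _ (fun k => UAB_unitary g gv hg hgc _)]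
    · simp only [vN_smul hH, htr, Finset.sum_add_distrib, ← Finset.sum_mul, hps]
      simp
    · intro k
      rw [Matrix.IsHermitian, Matrix.conjTranspose_smul, hH.eq]
      simp
  have hS : vN (redAB1 (proj ψ)) = vN (redB2 (proj ψ)) := by
    rw [redAB1_pure, redB2_pure, vN_schmidt]
  have hW1 : vN (redAB1 (omega3 g (proj ψ))) = ∑ l, vN (amp g ψ l * (amp g ψ l)ᴴ) := by
    rw [redAB1_omega, ← vN_cq g hg (fun _ => 1) (by simp) _
      (fun l => Matrix.isHermitian_mul_conjTranspose_self _)]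
    simp
  have hW2 : vN (redAB2 (omega3 g (proj ψ))) = ∑ l, vN (amp g ψ l * (amp g ψ l)ᴴ) := by
    rw [Finset.sum_congr rfl fun l _ => vN_schmidt (amp g ψ l)]
    rw [redAB2_omega, ← vN_cq g hg (fun _ => 1) (by simp) _
      (fun l => Matrix.isHermitian_mul_conjTranspose_self _)]
    simp
  have hWA : vN (redA3 (omega3 g (proj ψ))) ≤ ∑ l, vN (amp g ψ l * (amp g ψ l)ᴴ) := by
    rw [redA3_omega, vN_classical g hg]
    exact Finset.sum_le_sum fun l _ => vN_ge (Matrix.posSemidef_self_mul_conjTranspose _)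
  have hB2 : 0 ≤ vN (redB2 (proj ψ)) := by
    rw [← hS]
    have h := vN_ge (M := redAB1 (proj ψ))
      (by rw [redAB1_pure]; exact Matrix.posSemidef_self_mul_conjTranspose _)
    rw [htr] at h
    simpa using h
  have hD : relent (redAB1four (kappa3 p rb rv g gv (proj ψ))) (redAB1 (omega3 g (proj ψ)))
      = - vN (redAB1four (kappa3 p rb rv g gv (proj ψ))) + vN (redAB1 (omega3 g (proj ψ))) := by
    apply relent_pinch (fun l => proj (g l) ⊗ₖ (1 : Matrix iB1 iB1 ℂ))
    · rw [redAB1_omega, Matrix.IsHermitian, Matrix.conjTranspose_sum]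
      refine Finset.sum_congr rfl fun l _ => ?_
      rw [Matrix.conjTranspose_kronecker, proj_herm,
        (Matrix.isHermitian_mul_conjTranspose_self _).eq]
    · intro l l'
      rw [← Matrix.mul_kronecker_mul, proj_mul, hg]
      split_ifs with h
      · subst h; simp [proj]
      · simp
    · have : ∑ l, proj (g l) ⊗ₖ (1 : Matrix iB1 iB1 ℂ)
          = (∑ l, proj (g l)) ⊗ₖ (1 : Matrix iB1 iB1 ℂ) := by
        ext i j
        simp [Matrix.sum_apply, Finset.sum_mul]
      rw [this, hgc]; simp
    · rw [redAB1four_kappa p rb hrb]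
      exact redAB1_omega_pinch p hps rv g gv hg _
  rw [max_eq_left, hD, hR, hRAB, hS, hW1, hW2]
  · ring
  · rw [hρ0, hW1]; linarith
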